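/- For every m ≥ 2, the reverse of the greedy sequence equals the humble sequence. -/

import Mathlib

open List

/-- The initial configuration `(1, 2, …, m)`. -/
def initConfig (m : ℕ) : List ℕ := (List.range m).map (· + 1)

/-- A move at index `i` (with `1 ≤ i ≤ m-1`) transposes the entries `q_i` and `q_{i+1}`
(one-indexed), i.e. the entries at zero-indexed positions `i-1` and `i`. -/
def swapAdj (q : List ℕ) (i : ℕ) : List ℕ :=
  (q.set (i - 1) (q.getD i 0)).set i (q.getD (i - 1) 0)

/-- The prefix set `S_k(q) = {q_1, …, q_k}`. -/
def prefixSet (q : List ℕ) (k : ℕ) : Finset ℕ := (q.take k).toFinset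

/-- The initial prefix sets `S_0 ⊂ S_1 ⊂ … ⊂ S_m` of the configuration `(1,…,m)`. -/
def initSets (m : ℕ) : List (Finset ℕ) :=
  (List.range (m + 1)).map (fun k => prefixSet (initConfig m) k)

/-- The sets generated by applying a sequence of moves starting from configuration `q`:
the `t`-th generated set is the prefix set of length `i_t` of the configuration
obtained after the `t`-th move. -/
def genSetsAux (q : List ℕ) : List ℕ → List (Finset ℕ)
  | [] => []
  | i :: rest => prefixSet (swapAdj q i) i :: genSetsAux (swapAdj q i) rest

/-- The sets generated by the moves, starting from the initial configuration `(1,…,m)`. -/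
def genSets (m : ℕ) (moves : List ℕ) : List (Finset ℕ) :=
  genSetsAux (initConfig m) moves

/-- `moves` is a stepping sequence for `m`: each move index lies in `{1,…,m-1}`, and the
initial prefix sets `S_0,…,S_m` together with the generated sets list every subset of
`{1,…,m}` exactly once. -/
def IsSteppingSeq (m : ℕ) (moves : List ℕ) : Prop :=
  (∀ i ∈ moves, 1 ≤ i ∧ i ≤ m - 1) ∧
  (initSets m ++ genSets m moves).Perm (Finset.Icc 1 m).powerset.toList

/-- One run of the greedy method: repeatedly perform the move at the largest index
`i ∈ {1,…,m-1}` such that the set generated by that move has not been seen before,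
recording the chosen indices. -/
def greedyAux (m : ℕ) : ℕ → List ℕ → Finset (Finset ℕ) → List ℕ
  | 0, _, _ => []
  | fuel + 1, q, seen =>
    let J := (Finset.Icc 1 (m - 1)).filter (fun i => prefixSet (swapAdj q i) i ∉ seen)
    if h : J.Nonempty then
      let j := J.max' h
      j :: greedyAux m fuel (swapAdj q j) (insert (prefixSet (swapAdj q j) j) seen)
    else []

/-- The greedy sequence for `m`: start from the configuration `(1,…,m)` with the initial
prefix sets marked as seen; the fuel `2^m` never runs out since at most `2^m - m - 1`
moves are possible. -/
def greedySeq (m : ℕ) : List ℕ :=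
  greedyAux m (2 ^ m) (initConfig m) (initSets m).toFinset

/-- One run of the humble method: repeatedly perform the move at the smallest index
`i ∈ {1,…,m-1}` such that the set generated by that move has not been seen before,
recording the chosen indices. -/
def humbleAux (m : ℕ) : ℕ → List ℕ → Finset (Finset ℕ) → List ℕ
  | 0, _, _ => []
  | fuel + 1, q, seen =>
    let J := (Finset.Icc 1 (m - 1)).filter (fun i => prefixSet (swapAdj q i) i ∉ seen)
    if h : J.Nonempty then
      let j := J.min' h
      j :: humbleAux m fuel (swapAdj q j) (insert (prefixSet (swapAdj q j) j) seen)
    else []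

/-- The humble sequence for `m`. -/
def humbleSeq (m : ℕ) : List ℕ :=
  humbleAux m (2 ^ m) (initConfig m) (initSets m).toFinset

/-- The set generated by a move at index `i` from the configuration `q`. -/
def newSet (q : List ℕ) (i : ℕ) : Finset ℕ := prefixSet (swapAdj q i) i

/-- The index `j` is admissible, and no index `i` with `R j i` is. -/
structure Picks (R : ℕ → ℕ → Prop) (q : List ℕ) (S : Set (Finset ℕ)) (j : ℕ) : Prop where
  one_le : 1 ≤ j
  lt_length : j < q.length
  notMem : newSet q j ∉ S
  mem_of_rel : ∀ i, 1 ≤ i → i < q.length → R j i → newSet q i ∈ S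

/-- `Run R q S l q' S'`: successively choosing `R`-extremal admissible indices, one can make the
moves `l` from configuration `q` with seen sets `S`, reaching `q'` with seen sets `S'`. -/
inductive Run (R : ℕ → ℕ → Prop) :
    List ℕ → Set (Finset ℕ) → List ℕ → List ℕ → Set (Finset ℕ) → Prop
  | nil (q S) : Run R q S [] q S
  | cons {q S j l q' S'} : Picks R q S j → Run R (swapAdj q j) (insert (newSet q j) S) l q' S' →
      Run R q S (j :: l) q' S'

/-- The sets `U` with `U \ {x} ∈ A` if `x ∈ U`, and `U ∈ B` otherwise. -/
def glue (x : ℕ) (A B : Set (Finset ℕ)) : Set (Finset ℕ) :=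
  {U | (x ∈ U → U.erase x ∈ A) ∧ (x ∉ U → U ∈ B)}

/-- The prefix sets of `q`. -/
def prefixSets (q : List ℕ) : Set (Finset ℕ) := {T | ∃ k, T = prefixSet q k}

/-- The sets of entries of `q`. -/
def subsetsOf (q : List ℕ) : Set (Finset ℕ) := {T | T ⊆ q.toFinset}

theorem exists_eq_append_of_lt_length {q : List ℕ} {i : ℕ} (h1 : 1 ≤ i) (h2 : i < q.length) :
    ∃ u a b v, q = u ++ a :: b :: v ∧ i = u.length + 1 := by
  obtain ⟨k, rfl⟩ : ∃ k, i = k + 1 := ⟨i - 1, by omega⟩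
  refine ⟨q.take k, q[k], q[k + 1], q.drop (k + 2), ?_, ?_⟩
  · rw [← List.drop_eq_getElem_cons, ← List.drop_eq_getElem_cons, List.take_append_drop]
  · rw [List.length_take]
    omega

theorem swapAdj_append (u : List ℕ) (a b : ℕ) (v : List ℕ) :
    swapAdj (u ++ a :: b :: v) (u.length + 1) = u ++ b :: a :: v := by
  simp [swapAdj, List.getD]

theorem newSet_append (u : List ℕ) (a b : ℕ) (v : List ℕ) :
    newSet (u ++ a :: b :: v) (u.length + 1) = insert b u.toFinset := by
  ext
  simp [newSet, swapAdj_append, prefixSet, List.take_append, List.take_of_length_le]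

theorem swapAdj_perm {q : List ℕ} {i : ℕ} (h1 : 1 ≤ i) (h2 : i < q.length) :
    (swapAdj q i).Perm q := by
  obtain ⟨u, a, b, v, rfl, rfl⟩ := exists_eq_append_of_lt_length h1 h2
  rw [swapAdj_append]
  exact (List.Perm.swap _ _ _).append_left u

theorem newSet_subset {q : List ℕ} {i : ℕ} (h1 : 1 ≤ i) (h2 : i < q.length) :
    newSet q i ⊆ q.toFinset := by
  obtain ⟨u, a, b, v, rfl, rfl⟩ := exists_eq_append_of_lt_length h1 h2
  rw [newSet_append]
  intro c
  simp
  tauto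

theorem swapAdj_cons (x : ℕ) {q : List ℕ} {i : ℕ} (h1 : 1 ≤ i) (h2 : i < q.length) :
    swapAdj (x :: q) (i + 1) = x :: swapAdj q i := by
  obtain ⟨u, a, b, v, rfl, rfl⟩ := exists_eq_append_of_lt_length h1 h2
  rw [swapAdj_append]
  exact swapAdj_append (x :: u) a b v

theorem newSet_cons (x : ℕ) {q : List ℕ} {i : ℕ} (h1 : 1 ≤ i) (h2 : i < q.length) :
    newSet (x :: q) (i + 1) = insert x (newSet q i) := by
  obtain ⟨u, a, b, v, rfl, rfl⟩ := exists_eq_append_of_lt_length h1 h2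
  rw [newSet_append, Finset.insert_comm, ← List.toFinset_cons]
  exact newSet_append (x :: u) a b v

theorem swapAdj_append_right (w : List ℕ) {q : List ℕ} {i : ℕ} (h1 : 1 ≤ i) (h2 : i < q.length) :
    swapAdj (q ++ w) i = swapAdj q i ++ w := by
  obtain ⟨u, a, b, v, rfl, rfl⟩ := exists_eq_append_of_lt_length h1 h2
  simp only [List.append_assoc, List.cons_append, swapAdj_append]

theorem newSet_append_right (w : List ℕ) {q : List ℕ} {i : ℕ} (h1 : 1 ≤ i) (h2 : i < q.length) :
    newSet (q ++ w) i = newSet q i := by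
  obtain ⟨u, a, b, v, rfl, rfl⟩ := exists_eq_append_of_lt_length h1 h2
  simp only [List.append_assoc, List.cons_append, newSet_append]

theorem insert_mem_glue {x : ℕ} {T : Finset ℕ} (hx : x ∉ T) (A B : Set (Finset ℕ)) :
    insert x T ∈ glue x A B ↔ T ∈ A := by
  simp [glue, hx]

theorem mem_glue {x : ℕ} {T : Finset ℕ} (hx : x ∉ T) (A B : Set (Finset ℕ)) :
    T ∈ glue x A B ↔ T ∈ B := by
  simp [glue, hx]

theorem glue_ext {x : ℕ} {A B S : Set (Finset ℕ)}
    (h1 : ∀ T, x ∉ T → (insert x T ∈ S ↔ T ∈ A)) (h2 : ∀ T, x ∉ T → (T ∈ S ↔ T ∈ B)) :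
    S = glue x A B := by
  ext U
  by_cases hU : x ∈ U
  · rw [← Finset.insert_erase hU, h1 _ (Finset.notMem_erase x U),
      insert_mem_glue (Finset.notMem_erase x U)]
  · rw [h2 U hU, mem_glue hU]

theorem insert_insert_glue {x : ℕ} {T : Finset ℕ} (hx : x ∉ T) (A B : Set (Finset ℕ)) :
    insert (insert x T) (glue x A B) = glue x (insert T A) B := by
  apply glue_ext
  · intro U hU
    rw [Set.mem_insert_iff, Set.mem_insert_iff, insert_mem_glue hU]
    refine or_congr_left ⟨fun h => ?_, fun h => by rw [h]⟩
    rw [← Finset.erase_insert hU, h, Finset.erase_insert hx]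
  · intro U hU
    rw [Set.mem_insert_iff, mem_glue hU, or_iff_right]
    rintro rfl
    simp at hU

theorem insert_glue {x : ℕ} {T : Finset ℕ} (hx : x ∉ T) (A B : Set (Finset ℕ)) :
    insert T (glue x A B) = glue x A (insert T B) := by
  apply glue_ext
  · intro U hU
    rw [Set.mem_insert_iff, insert_mem_glue hU, or_iff_right]
    rintro rfl
    simp at hx
  · intro U hU
    rw [Set.mem_insert_iff, Set.mem_insert_iff, mem_glue hU]

namespace Run

variable {R : ℕ → ℕ → Prop}

theorem perm {q S l q' S'} (h : Run R q S l q' S') : q'.Perm q := by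
  induction h with
  | nil => exact .refl _
  | cons hp _ ih => exact ih.trans (swapAdj_perm hp.one_le hp.lt_length)

theorem trans {q S l q' S' l' q'' S''} (h : Run R q S l q' S') (h' : Run R q' S' l' q'' S'') :
    Run R q S (l ++ l') q'' S'' := by
  induction h with
  | nil => exact h'
  | cons hp _ ih => exact .cons hp (ih h')

/-- Prepending an entry shifts a run. -/
theorem map_succ {x : ℕ} {p A l p' A'} (B : Set (Finset ℕ)) (h : Run R p A l p' A')
    (hx : x ∉ p) (hR : ∀ i j, R (i + 1) (j + 1) → R i j)
    (hB : ∀ j ≥ 1, R (j + 1) 1 → subsetsOf p ⊆ B) :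
    Run R (x :: p) (glue x A B) (l.map (· + 1)) (x :: p') (glue x A' B) := by
  induction h with
  | nil => exact .nil _ _
  | @cons q S j l q' S' hp _ ih =>
    obtain ⟨h1, h2, h3, h4⟩ := hp
    have hperm := swapAdj_perm h1 h2
    have hx' : ∀ i, 1 ≤ i → i < q.length → x ∉ newSet q i := fun i hi hi' hxi =>
      hx (List.mem_toFinset.1 (newSet_subset hi hi' hxi))
    refine .cons ⟨Nat.le_add_left 1 j, by simpa using h2, ?_, ?_⟩ ?_
    · rwa [newSet_cons x h1 h2, insert_mem_glue (hx' j h1 h2)]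
    · intro i hi hi' hRi
      obtain rfl | ⟨k, hk, rfl⟩ : i = 1 ∨ ∃ k, 1 ≤ k ∧ i = k + 1 := by
        by_cases h : i = 1
        · exact .inl h
        · exact .inr ⟨i - 1, by omega, by omega⟩
      · obtain ⟨y, w, rfl⟩ : ∃ y w, q = y :: w := List.exists_cons_of_length_pos (Nat.zero_lt_of_lt h2)
        have : newSet (x :: y :: w) 1 = {y} := newSet_append [] x y w
        rw [this, mem_glue (by simp at hx ⊢; tauto)]
        exact hB j h1 hRi (by simp [subsetsOf])
      · have hk' : k < q.length := by simpa using hi'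
        rw [newSet_cons x hk hk', insert_mem_glue (hx' k hk hk')]
        exact h4 k hk hk' (hR _ _ hRi)
    · rw [swapAdj_cons x h1 h2, newSet_cons x h1 h2, insert_insert_glue (hx' j h1 h2)]
      refine ih (by rwa [hperm.mem_iff]) fun k hk hRk => ?_
      rw [subsetsOf, List.toFinset_eq_of_perm _ _ hperm]
      exact hB k hk hRk

/-- Appending an entry preserves a run. -/
theorem concat {x : ℕ} {p B l p' B'} (A : Set (Finset ℕ)) (h : Run R p B l p' B')
    (hx : x ∉ p) (hA : ∀ j < p.length, R j p.length → subsetsOf p ⊆ A) :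
    Run R (p ++ [x]) (glue x A B) l (p' ++ [x]) (glue x A B') := by
  induction h with
  | nil => exact .nil _ _
  | @cons q S j l q' S' hp _ ih =>
    obtain ⟨h1, h2, h3, h4⟩ := hp
    have hperm := swapAdj_perm h1 h2
    have hx' : ∀ i, 1 ≤ i → i < q.length → x ∉ newSet q i := fun i hi hi' hxi =>
      hx (List.mem_toFinset.1 (newSet_subset hi hi' hxi))
    refine .cons ⟨h1, h2.trans_le (by simp), ?_, ?_⟩ ?_
    · rwa [newSet_append_right _ h1 h2, mem_glue (hx' j h1 h2)]
    · intro i hi hi' hRi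
      simp only [List.length_append, List.length_cons, List.length_nil] at hi'
      obtain rfl | hk := Nat.eq_or_lt_of_le (Nat.le_of_lt_succ hi')
      · obtain ⟨w, y, rfl⟩ : ∃ w y, q = w ++ [y] :=
          ⟨q.dropLast, q.getLast (List.ne_nil_of_length_pos hi),
            (List.dropLast_append_getLast _).symm⟩
        have : newSet (w ++ [y] ++ [x]) (w ++ [y]).length = insert x w.toFinset := by
          rw [List.append_assoc, List.length_append]
          exact newSet_append w y x []
        rw [this, insert_mem_glue (by simp at hx ⊢; tauto)]
        refine hA j h2 hRi fun c => ?_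
        simp
        tauto
      · rw [newSet_append_right _ hi hk, mem_glue (hx' i hi hk)]
        exact h4 i hi hk hRi
    · rw [swapAdj_append_right _ h1 h2, newSet_append_right _ h1 h2, insert_glue (hx' j h1 h2)]
      refine ih (by rwa [hperm.mem_iff]) ?_
      rw [subsetsOf, List.toFinset_eq_of_perm _ _ hperm, hperm.length_eq]
      exact hA

end Run

theorem prefixSet_append_left {u : List ℕ} {k : ℕ} (v : List ℕ) (hk : k ≤ u.length) :
    prefixSet (u ++ v) k = prefixSet u k := by
  simp [prefixSet, List.take_append_of_le_length hk]

theorem prefixSet_of_length_le {u : List ℕ} {k : ℕ} (hk : u.length ≤ k) :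
    prefixSet u k = u.toFinset := by
  rw [prefixSet, List.take_of_length_le hk]

theorem prefixSet_append_length (u v : List ℕ) : prefixSet (u ++ v) u.length = u.toFinset := by
  simp [prefixSet]

theorem prefixSet_subset (u : List ℕ) (k : ℕ) : prefixSet u k ⊆ u.toFinset := fun a h => by
  rw [prefixSet, List.mem_toFinset] at h
  exact List.mem_toFinset.2 (List.mem_of_mem_take h)

theorem prefixSets_nil : prefixSets [] = {∅} := by
  ext
  simp [prefixSets, prefixSet]

theorem prefixSets_concat (u : List ℕ) (y : ℕ) :
    prefixSets (u ++ [y]) = insert (insert y u.toFinset) (prefixSets u) := by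
  have hfull : (u ++ [y]).toFinset = insert y u.toFinset := by
    ext
    simp
  ext T
  constructor
  · rintro ⟨k, rfl⟩
    rcases Nat.lt_or_ge u.length k with hk | hk
    · left
      rw [prefixSet_of_length_le (by simpa using hk), hfull]
    · exact .inr ⟨k, prefixSet_append_left _ hk⟩
  · rintro (rfl | ⟨k, rfl⟩)
    · exact ⟨u.length + 1, by rw [prefixSet_of_length_le (by simp), hfull]⟩
    · refine ⟨min k u.length, ?_⟩
      rw [prefixSet_append_left _ (min_le_right _ _), prefixSet, prefixSet, List.take_eq_take_min]

theorem prefixSets_cons_eq_glue {x : ℕ} {p : List ℕ} (hx : x ∉ p) :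
    prefixSets (x :: p) = glue x (prefixSets p) {∅} := by
  have hT : ∀ k, x ∉ prefixSet p k := fun k h =>
    hx (List.mem_toFinset.1 (prefixSet_subset p k h))
  have hsucc : ∀ k, prefixSet (x :: p) (k + 1) = insert x (prefixSet p k) := fun k => by
    simp [prefixSet]
  have hzero : prefixSet (x :: p) 0 = ∅ := rfl
  apply glue_ext
  · intro T hxT
    constructor
    · rintro ⟨_ | k, hk⟩
      · simp [hzero] at hk
      · rw [hsucc] at hk
        exact ⟨k, by rw [← Finset.erase_insert hxT, hk, Finset.erase_insert (hT k)]⟩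
    · rintro ⟨k, rfl⟩
      exact ⟨k + 1, (hsucc k).symm⟩
  · intro T hxT
    constructor
    · rintro ⟨_ | k, rfl⟩
      · exact hzero
      · simp [hsucc] at hxT
    · rintro rfl
      exact ⟨0, rfl⟩

theorem prefixSets_concat_eq_glue {x : ℕ} {p : List ℕ} (hx : x ∉ p) :
    prefixSets (p ++ [x]) = glue x {p.toFinset} (prefixSets p) := by
  rw [prefixSets_concat]
  apply glue_ext
  · intro T hxT
    rw [Set.mem_insert_iff, or_iff_left, Set.mem_singleton_iff]
    · refine ⟨fun h => ?_, fun h => by rw [h]⟩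
      rw [← Finset.erase_insert hxT, h, Finset.erase_insert (by simpa using hx)]
    · rintro ⟨k, hk⟩
      exact hx (List.mem_toFinset.1 (prefixSet_subset p k (hk ▸ Finset.mem_insert_self x T)))
  · intro T hxT
    rw [Set.mem_insert_iff, or_iff_right]
    rintro rfl
    simp at hxT

theorem subsetsOf_eq_of_perm {p q : List ℕ} (h : p.Perm q) : subsetsOf p = subsetsOf q := by
  rw [subsetsOf, subsetsOf, List.toFinset_eq_of_perm _ _ h]

theorem subsetsOf_cons_eq_glue (x : ℕ) (p : List ℕ) :
    subsetsOf (x :: p) = glue x (subsetsOf p) (subsetsOf p) := by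
  apply glue_ext
  · intro T hxT
    simp [subsetsOf, Finset.insert_subset_insert_iff hxT]
  · intro T hxT
    simp [subsetsOf, Finset.subset_insert_iff_of_notMem hxT]

/-- The greedy method carries a first entry `x` to the end once all sets containing it are seen. -/
theorem Run.greedy_move_right {x : ℕ} (v : List ℕ) : ∀ u : List ℕ, (u ++ x :: v).Nodup →
    Run (· < ·) (u ++ x :: v) (glue x (subsetsOf (u ++ v)) (prefixSets u))
      (List.range' (u.length + 1) v.length) (u ++ v ++ [x])
      (glue x (subsetsOf (u ++ v)) (prefixSets (u ++ v))) := by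
  induction v with
  | nil =>
    intro u _
    simpa using Run.nil _ _
  | cons y v ih =>
    intro u hnd
    have hperm : (u ++ x :: y :: v).Perm (x :: y :: (u ++ v)) :=
      List.perm_middle.trans (List.perm_middle.cons x)
    obtain ⟨hx, hnd'⟩ := List.nodup_cons.1 (hperm.nodup_iff.1 hnd)
    obtain ⟨hy, -⟩ := List.nodup_cons.1 hnd'
    have hxT : x ∉ insert y u.toFinset := by
      simp at hx ⊢
      tauto
    rw [List.length_cons, List.range'_succ]
    refine .cons ⟨by omega, by simp, ?_, ?_⟩ ?_
    · rw [newSet_append, mem_glue hxT]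
      rintro ⟨k, hk⟩
      have := prefixSet_subset u k (hk ▸ Finset.mem_insert_self y _)
      simp at this hy
      tauto
    · intro i hi hi' hlt
      obtain ⟨w, a, b, z, hw, rfl⟩ := exists_eq_append_of_lt_length hi hi'
      have hsub := newSet_subset hi hi'
      have hxw : x ∈ newSet (u ++ x :: y :: v) (w.length + 1) := by
        rw [hw, newSet_append]
        obtain ⟨t, rfl⟩ : u ++ [x] <+: w := by
          refine List.prefix_of_prefix_length_le (l₃ := u ++ x :: y :: v) ⟨y :: v, by simp⟩
            ⟨a :: b :: z, hw.symm⟩ ?_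
          simp
          omega
        simp
      rw [← Finset.insert_erase hxw, insert_mem_glue (Finset.notMem_erase _ _)]
      refine (Finset.erase_subset_erase x hsub).trans fun c => ?_
      simp
    · rw [swapAdj_append, newSet_append, insert_glue hxT, ← prefixSets_concat]
      have := ih (u ++ [y]) (by
        refine (List.Perm.nodup_iff ?_).1 hnd
        simpa using (List.Perm.swap y x v).append_left u)
      simpa using this

/-- The humble method carries a last entry `x` to the front once all sets avoiding it are seen. -/
theorem Run.humble_move_left {x : ℕ} (u : List ℕ) : ∀ v : List ℕ, (u ++ x :: v).Nodup →
    Run (· > ·) (u ++ x :: v)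
      (glue x {T | ∃ k, u.length ≤ k ∧ T = prefixSet (u ++ v) k} (subsetsOf (u ++ v)))
      (List.range' 1 u.length).reverse (x :: (u ++ v))
      (glue x (prefixSets (u ++ v)) (subsetsOf (u ++ v))) := by
  induction u using List.reverseRecOn with
  | nil =>
    intro v _
    simpa [prefixSets] using Run.nil _ _
  | append_singleton u y ih =>
    intro v hnd
    have hnd2 : (u ++ y :: x :: v).Nodup := by simpa using hnd
    have hperm : (u ++ y :: x :: v).Perm (y :: x :: (u ++ v)) :=
      List.perm_middle.trans (List.perm_middle.cons y)
    obtain ⟨hy, hnd'⟩ := List.nodup_cons.1 (hperm.nodup_iff.1 hnd2)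
    obtain ⟨hx, -⟩ := List.nodup_cons.1 hnd'
    have hxT : x ∉ u.toFinset := by
      simp at hx ⊢
      tauto
    have hassoc : ∀ w, u ++ [y] ++ w = u ++ y :: w := by simp
    have hset : insert u.toFinset
        {T | ∃ k, (u ++ [y]).length ≤ k ∧ T = prefixSet (u ++ y :: v) k} =
        {T | ∃ k, u.length ≤ k ∧ T = prefixSet (u ++ y :: v) k} := by
      ext T
      constructor
      · rintro (rfl | ⟨k, hk, rfl⟩)
        · exact ⟨u.length, le_rfl, (prefixSet_append_length _ _).symm⟩
        · exact ⟨k, by simp at hk; omega, rfl⟩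
      · rintro ⟨k, hk, rfl⟩
        obtain rfl | hk := Nat.eq_or_lt_of_le hk
        · exact .inl (prefixSet_append_length _ _)
        · exact .inr ⟨k, by simpa using hk, rfl⟩
    have hlen : (List.range' 1 (u ++ [y]).length).reverse =
        (u.length + 1) :: (List.range' 1 u.length).reverse := by
      rw [List.length_append, List.length_singleton, List.range'_concat]
      simp [add_comm]
    rw [hlen, hassoc, hassoc]
    refine .cons ⟨by omega, by simp, ?_, ?_⟩ ?_
    · rw [newSet_append, insert_mem_glue hxT]
      rintro ⟨k, hk, hk'⟩
      have hyk : y ∈ prefixSet (u ++ y :: v) k := by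
        rw [← hassoc, prefixSet, List.take_append, List.take_of_length_le hk]
        simp
      rw [← hk'] at hyk
      simp at hyk hy
      tauto
    · intro i hi hi' hlt
      have hi'' : i < (u ++ [y]).length := by simpa using hlt
      rw [← hassoc (x :: v), newSet_append_right _ hi hi'']
      have hsub := newSet_subset hi hi''
      rw [mem_glue]
      · refine hsub.trans fun c => ?_
        simp
        tauto
      · intro hmem
        have := hsub hmem
        simp at this hy hx
        tauto
    · rw [swapAdj_append, newSet_append, insert_insert_glue hxT, hset]
      refine ih (y :: v) ((List.Perm.nodup_iff ?_).1 hnd2)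
      exact (List.Perm.swap x y v).append_left u

/-- The greedy moves for configurations of length `n`. -/
def greedyMoves : ℕ → List ℕ
  | 0 => []
  | n + 1 => (greedyMoves n).map (· + 1) ++ List.range' 1 n ++ greedyMoves n

/-- The humble moves for configurations of length `n`. -/
def humbleMoves : ℕ → List ℕ
  | 0 => []
  | n + 1 => humbleMoves n ++ (List.range' 1 n).reverse ++ (humbleMoves n).map (· + 1)

theorem greedyMoves_reverse (n : ℕ) : (greedyMoves n).reverse = humbleMoves n := by
  induction n with
  | zero => rfl
  | succ n ih => simp [greedyMoves, humbleMoves, ← ih]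

theorem length_greedyMoves (n : ℕ) : (greedyMoves n).length + n + 1 = 2 ^ n := by
  induction n with
  | zero => rfl
  | succ n ih =>
    simp [greedyMoves, pow_succ]
    omega

theorem exists_run_greedyMoves (n : ℕ) : ∀ q : List ℕ, q.length = n → q.Nodup →
    ∃ q', Run (· < ·) q (prefixSets q) (greedyMoves n) q' (subsetsOf q) := by
  induction n with
  | zero =>
    intro q hq _
    obtain rfl := List.length_eq_zero_iff.1 hq
    have : prefixSets [] = subsetsOf [] := by
      rw [prefixSets_nil]
      ext
      simp [subsetsOf]
    exact ⟨[], this ▸ .nil _ _⟩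
  | succ n ih =>
    intro q hq hnd
    obtain ⟨x, p, rfl⟩ : ∃ x p, q = x :: p := List.exists_cons_of_length_pos (by omega)
    obtain ⟨hx, hp⟩ := List.nodup_cons.1 hnd
    have hn : p.length = n := by simpa using hq
    obtain ⟨p', h1⟩ := ih p hn hp
    have hperm := h1.perm
    have hx' : x ∉ p' := by rwa [hperm.mem_iff]
    have hn' : p'.length = n := hperm.length_eq.trans hn
    have hp' : p'.Nodup := hperm.nodup_iff.2 hp
    obtain ⟨r, h3⟩ := ih p' hn' hp'
    have h1' := h1.map_succ {∅} hx (fun i j h => by omega) (fun j hj h => by omega)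
    have h2' := Run.greedy_move_right p' [] (List.nodup_cons.2 ⟨hx', hp'⟩)
    have h3' := h3.concat (subsetsOf p') hx' (fun _ _ _ => le_rfl)
    simp only [List.nil_append, prefixSets_nil, List.length_nil, Nat.zero_add, hn'] at h2'
    rw [← subsetsOf_eq_of_perm hperm, ← prefixSets_cons_eq_glue hx] at h1'
    rw [← subsetsOf_cons_eq_glue x p', subsetsOf_eq_of_perm (hperm.cons x)] at h3'
    exact ⟨r ++ [x], (h1'.trans h2').trans h3'⟩

theorem exists_run_humbleMoves (n : ℕ) : ∀ q : List ℕ, q.length = n → q.Nodup →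
    ∃ q', Run (· > ·) q (prefixSets q) (humbleMoves n) q' (subsetsOf q) := by
  induction n with
  | zero =>
    intro q hq _
    obtain rfl := List.length_eq_zero_iff.1 hq
    have : prefixSets [] = subsetsOf [] := by
      rw [prefixSets_nil]
      ext
      simp [subsetsOf]
    exact ⟨[], this ▸ .nil _ _⟩
  | succ n ih =>
    intro q hq hnd
    obtain ⟨p, x, rfl⟩ : ∃ p x, q = p ++ [x] :=
      ⟨q.dropLast, q.getLast (List.ne_nil_of_length_pos (by omega)),
        (List.dropLast_append_getLast _).symm⟩
    have hpx : (p ++ [x]).Perm (x :: p) := List.perm_append_singleton x p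
    obtain ⟨hx, hp⟩ := List.nodup_cons.1 (hpx.nodup_iff.1 hnd)
    have hn : p.length = n := by simpa using hq
    obtain ⟨p', h1⟩ := ih p hn hp
    have hperm := h1.perm
    have hx' : x ∉ p' := by rwa [hperm.mem_iff]
    have hn' : p'.length = n := hperm.length_eq.trans hn
    have hp' : p'.Nodup := hperm.nodup_iff.2 hp
    obtain ⟨r, h3⟩ := ih p' hn' hp'
    have h1' := h1.concat {p.toFinset} hx (fun j hj h => by omega)
    have h2' := Run.humble_move_left p' []
      ((List.perm_append_singleton x p').nodup_iff.2 (List.nodup_cons.2 ⟨hx', hp'⟩))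
    have h3' := h3.map_succ (subsetsOf p') hx' (fun i j h => by omega) (fun _ _ _ => le_rfl)
    have htop : {T | ∃ k, n ≤ k ∧ T = prefixSet p' k} = {p.toFinset} := by
      rw [← List.toFinset_eq_of_perm _ _ hperm]
      ext T
      constructor
      · rintro ⟨k, hk, rfl⟩
        exact prefixSet_of_length_le (hn'.trans_le hk)
      · rintro rfl
        exact ⟨n, le_rfl, (prefixSet_of_length_le hn'.le).symm⟩
    rw [List.append_nil, hn', htop] at h2'
    rw [← subsetsOf_eq_of_perm hperm, ← prefixSets_concat_eq_glue hx] at h1'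
    rw [← subsetsOf_cons_eq_glue x p', subsetsOf_eq_of_perm ((hperm.cons x).trans hpx.symm)] at h3'
    exact ⟨x :: r, (h1'.trans h2').trans h3'⟩

theorem filter_notMem_eq_empty {m : ℕ} {q : List ℕ} (hm : q.length = m) {S : Finset (Finset ℕ)}
    (h : subsetsOf q ⊆ S) :
    (Finset.Icc 1 (m - 1)).filter (fun i => prefixSet (swapAdj q i) i ∉ S) = ∅ := by
  refine Finset.filter_eq_empty_iff.2 fun i hi => not_not.2 ?_
  rw [Finset.mem_Icc] at hi
  exact h (newSet_subset hi.1 (by omega))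

theorem Picks.mem_filter {R : ℕ → ℕ → Prop} {m j : ℕ} {q : List ℕ} (hm : q.length = m)
    {S : Finset (Finset ℕ)} (h : Picks R q S j) :
    j ∈ (Finset.Icc 1 (m - 1)).filter (fun i => prefixSet (swapAdj q i) i ∉ S) := by
  have := h.one_le
  have := h.lt_length
  exact Finset.mem_filter.2 ⟨Finset.mem_Icc.2 ⟨by omega, by omega⟩, h.notMem⟩

theorem Picks.not_rel {R : ℕ → ℕ → Prop} {m i j : ℕ} {q : List ℕ} (hm : q.length = m)
    {S : Finset (Finset ℕ)} (h : Picks R q S j)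
    (hi : i ∈ (Finset.Icc 1 (m - 1)).filter (fun i => prefixSet (swapAdj q i) i ∉ S)) :
    ¬ R j i := by
  rw [Finset.mem_filter, Finset.mem_Icc] at hi
  exact fun hR => hi.2 (h.mem_of_rel i hi.1.1 (by omega) hR)

theorem greedyAux_eq_of_run {m : ℕ} {q : List ℕ} {S : Set (Finset ℕ)} {l q' : List ℕ}
    {S' : Set (Finset ℕ)} (h : Run (· < ·) q S l q' S') : ∀ (fuel : ℕ) (F : Finset (Finset ℕ)),
    q.length = m → ↑F = S → subsetsOf q ⊆ S' → l.length ≤ fuel → greedyAux m fuel q F = l := by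
  induction h with
  | nil q S =>
    rintro (_ | fuel) F hm rfl hS -
    · rfl
    · simp [greedyAux, filter_notMem_eq_empty hm hS]
  | @cons q S j l q' S' hp _ ih =>
    rintro (_ | fuel) F hm rfl hS hl
    · simp at hl
    have hperm := swapAdj_perm hp.one_le hp.lt_length
    have hmem := hp.mem_filter hm
    have hmax : Finset.max' _ ⟨j, hmem⟩ = j :=
      le_antisymm (Finset.max'_le _ _ _ fun i hi => not_lt.1 (hp.not_rel hm hi))
        (Finset.le_max' _ _ hmem)
    simp only [greedyAux]
    rw [dif_pos ⟨j, hmem⟩, hmax]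
    congr 1
    refine ih fuel _ (hperm.length_eq.trans hm) (by simp [newSet]) ?_ (by simpa using hl)
    rwa [subsetsOf_eq_of_perm hperm]

theorem humbleAux_eq_of_run {m : ℕ} {q : List ℕ} {S : Set (Finset ℕ)} {l q' : List ℕ}
    {S' : Set (Finset ℕ)} (h : Run (· > ·) q S l q' S') : ∀ (fuel : ℕ) (F : Finset (Finset ℕ)),
    q.length = m → ↑F = S → subsetsOf q ⊆ S' → l.length ≤ fuel → humbleAux m fuel q F = l := by
  induction h with
  | nil q S =>
    rintro (_ | fuel) F hm rfl hS -
    · rfl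
    · simp [humbleAux, filter_notMem_eq_empty hm hS]
  | @cons q S j l q' S' hp _ ih =>
    rintro (_ | fuel) F hm rfl hS hl
    · simp at hl
    have hperm := swapAdj_perm hp.one_le hp.lt_length
    have hmem := hp.mem_filter hm
    have hmin : Finset.min' _ ⟨j, hmem⟩ = j :=
      le_antisymm (Finset.min'_le _ _ hmem)
        (Finset.le_min' _ _ _ fun i hi => not_lt.1 (hp.not_rel (R := (· > ·)) hm hi))
    simp only [humbleAux]
    rw [dif_pos ⟨j, hmem⟩, hmin]
    congr 1
    refine ih fuel _ (hperm.length_eq.trans hm) (by simp [newSet]) ?_ (by simpa using hl)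
    rwa [subsetsOf_eq_of_perm hperm]

theorem length_initConfig (m : ℕ) : (initConfig m).length = m := by
  simp [initConfig]

theorem nodup_initConfig (m : ℕ) : (initConfig m).Nodup :=
  List.nodup_range.map (add_left_injective 1)

theorem coe_initSets (m : ℕ) :
    ((initSets m).toFinset : Set (Finset ℕ)) = prefixSets (initConfig m) := by
  ext T
  simp only [initSets, List.coe_toFinset, List.mem_map, List.mem_range, Set.mem_ofPred_eq,
    prefixSets]
  constructor
  · rintro ⟨k, -, rfl⟩
    exact ⟨k, rfl⟩
  · rintro ⟨k, rfl⟩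
    rcases Nat.lt_or_ge k (m + 1) with hk | hk
    · exact ⟨k, hk, rfl⟩
    · have hl := length_initConfig m
      exact ⟨m, by omega, by
        rw [prefixSet_of_length_le (by omega), prefixSet_of_length_le (by omega)]⟩

theorem greedySeq_eq (m : ℕ) : greedySeq m = greedyMoves m := by
  obtain ⟨_, h⟩ := exists_run_greedyMoves m _ (length_initConfig m) (nodup_initConfig m)
  have := length_greedyMoves m
  exact greedyAux_eq_of_run h _ _ (length_initConfig m) (coe_initSets m) le_rfl (by omega)

theorem humbleSeq_eq (m : ℕ) : humbleSeq m = humbleMoves m := by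
  obtain ⟨_, h⟩ := exists_run_humbleMoves m _ (length_initConfig m) (nodup_initConfig m)
  have := length_greedyMoves m
  refine humbleAux_eq_of_run h _ _ (length_initConfig m) (coe_initSets m) le_rfl ?_
  rw [← greedyMoves_reverse, List.length_reverse]
  omega

/-- Lemma 3.2: the reverse of the greedy sequence equals the humble sequence. -/
theorem greedy_reverse_eq_humble (m : ℕ) (hm : 2 ≤ m) :
    (greedySeq m).reverse = humbleSeq m := by
  rw [greedySeq_eq, humbleSeq_eq, greedyMoves_reverse]
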